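/- Assume Δ_{k−1} ≠ 0 and Δ_{k+i} = 0 for i = 0,…,2j−1. Then for every i with 0 ≤ i ≤ j, a polynomial p_{k+i} of degree k+i is a formal orthogonal polynomial with respect to L if and only if it is quasi-orthogonal of order i with respect to L. -/

import Mathlib

open Polynomial Matrix

/-- `hankelDet m k` is the determinant of the `k × k` Hankel matrix with `(i,j)` entry
`m (i + j)` (0-indexed), i.e. the determinant `Δ_{k-1}` of the paper
(with `hankelDet m 0 = Δ_{-1} = 1`). -/
noncomputable def hankelDet (m : ℕ → ℂ) (k : ℕ) : ℂ :=
  (Matrix.of fun i j : Fin k => m ((i : ℕ) + (j : ℕ))).det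

lemma aux_L_sum (L : Polynomial ℂ →ₗ[ℂ] ℂ) (m : ℕ → ℂ) (hm : ∀ i, m i = L (X ^ i))
    (n : ℕ) (v : Fin n → ℂ) (t : ℕ) :
    L ((∑ i : Fin n, C (v i) * X ^ (i : ℕ)) * X ^ t) = ∑ i : Fin n, m (t + (i : ℕ)) * v i := by
  rw [Finset.sum_mul, map_sum]
  refine Finset.sum_congr rfl fun i _ => ?_
  rw [mul_assoc, ← pow_add, ← smul_eq_C_mul, map_smul, ← hm, smul_eq_mul, mul_comm, add_comm]

lemma aux_deg (n : ℕ) (v : Fin n → ℂ) :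
    (∑ i : Fin n, C (v i) * X ^ (i : ℕ) : ℂ[X]).degree < n := by
  refine (Polynomial.degree_sum_le _ _).trans_lt ?_
  refine (Finset.sup_lt_iff (WithBot.bot_lt_coe n)).2 ?_
  intro i _
  exact (degree_C_mul_X_pow_le _ _).trans_lt (WithBot.coe_lt_coe.2 i.2)

lemma aux_coeff (n : ℕ) (v : Fin n → ℂ) (i : Fin n) :
    (∑ i : Fin n, C (v i) * X ^ (i : ℕ) : ℂ[X]).coeff i = v i := by
  simp [coeff_C_mul, coeff_X_pow, Fin.val_inj]

lemma aux_mulVec (m : ℕ → ℂ) (n : ℕ) (v : Fin n → ℂ) (t : Fin n) :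
    ((Matrix.of fun i j : Fin n => m ((i : ℕ) + (j : ℕ))) *ᵥ v) t
      = ∑ i : Fin n, m ((t : ℕ) + (i : ℕ)) * v i := by
  simp [Matrix.mulVec, dotProduct]

/-- a singular Hankel matrix gives a polynomial in the radical -/
lemma aux_sing (L : Polynomial ℂ →ₗ[ℂ] ℂ) (m : ℕ → ℂ) (hm : ∀ i, m i = L (X ^ i))
    (n : ℕ) (h : hankelDet m n = 0) :
    ∃ r : ℂ[X], r ≠ 0 ∧ r.degree < n ∧ ∀ t < n, L (r * X ^ t) = 0 := by
  obtain ⟨v, hv, hv0⟩ := Matrix.exists_mulVec_eq_zero_iff.mpr h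
  refine ⟨∑ i : Fin n, C (v i) * X ^ (i : ℕ), ?_, aux_deg n v, ?_⟩
  · intro h0
    apply hv
    funext i
    rw [← aux_coeff n v i, h0]; simp
  · intro t ht
    rw [aux_L_sum L m hm]
    have := congrFun hv0 ⟨t, ht⟩
    rwa [aux_mulVec] at this

lemma aux_nonsing (L : Polynomial ℂ →ₗ[ℂ] ℂ) (m : ℕ → ℂ) (hm : ∀ i, m i = L (X ^ i))
    (n : ℕ) (h : hankelDet m n ≠ 0) (b : ℂ[X]) (hb : b.degree < n)
    (hL : ∀ t < n, L (b * X ^ t) = 0) : b = 0 := by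
  have e : b = ∑ i : Fin n, C (b.coeff i) * X ^ (i : ℕ) := by
    rw [Fin.sum_univ_eq_sum_range (fun i => C (b.coeff i) * X ^ i) n]
    by_cases h0 : b = 0
    · simp [h0]
    · exact Polynomial.as_sum_range_C_mul_X_pow' _ ((natDegree_lt_iff_degree_lt h0).2 hb)
  have hv : (fun i : Fin n => b.coeff i) = 0 := by
    by_contra hne
    apply h
    refine Matrix.exists_mulVec_eq_zero_iff.mp ⟨_, hne, ?_⟩
    funext t
    rw [aux_mulVec, ← aux_L_sum L m hm n (fun i : Fin n => b.coeff i), ← e]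
    exact hL t t.2
  rw [e]
  refine Finset.sum_eq_zero fun i _ => ?_
  rw [show b.coeff i = 0 from congrFun hv i]; simp

lemma aux_fop (L : Polynomial ℂ →ₗ[ℂ] ℂ) (m : ℕ → ℂ) (hm : ∀ i, m i = L (X ^ i))
    (n : ℕ) (h : hankelDet m n ≠ 0) :
    ∃ q : ℂ[X], q.Monic ∧ q.degree = n ∧ ∀ t < n, L (q * X ^ t) = 0 := by
  have hu : IsUnit (Matrix.of fun i j : Fin n => m ((i : ℕ) + (j : ℕ))) :=
    (Matrix.isUnit_iff_isUnit_det _).2 (isUnit_iff_ne_zero.2 h)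
  obtain ⟨v, hv⟩ := (Matrix.mulVec_surjective_iff_isUnit.2 hu) (fun t : Fin n => - m (t + n))
  refine ⟨X ^ n + ∑ i : Fin n, C (v i) * X ^ (i : ℕ), monic_X_pow_add (aux_deg n v), ?_, ?_⟩
  · rw [degree_add_eq_left_of_degree_lt] <;> simp [aux_deg]
  · intro t ht
    rw [add_mul, map_add, aux_L_sum L m hm, ← pow_add, ← hm]
    have := congrFun hv ⟨t, ht⟩
    rw [aux_mulVec] at this
    simp only at this
    rw [this, add_comm n t]; ring

/-- if `L (q X^s) = 0` for `s < N`, then `L (q a) = 0` for `deg a < N` -/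
lemma aux_ext (L : Polynomial ℂ →ₗ[ℂ] ℂ) (q : ℂ[X]) (N : ℕ)
    (h : ∀ s < N, L (q * X ^ s) = 0) (a : ℂ[X]) (ha : a.degree < N) : L (q * a) = 0 := by
  by_cases h0 : a = 0
  · simp [h0]
  rw [Polynomial.as_sum_range_C_mul_X_pow' _ ((natDegree_lt_iff_degree_lt h0).2 ha),
    Finset.mul_sum, map_sum]
  refine Finset.sum_eq_zero fun i hi => ?_
  rw [mul_left_comm, ← smul_eq_C_mul, map_smul, h i (Finset.mem_range.1 hi), smul_zero]

/-- division by `q` -/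
lemma aux_div (L : Polynomial ℂ →ₗ[ℂ] ℂ) (m : ℕ → ℂ) (hm : ∀ i, m i = L (X ^ i))
    (k : ℕ) (hΔ : hankelDet m k ≠ 0) (q : ℂ[X]) (hq : q.Monic) (hqd : q.degree = k)
    (i : ℕ) (h : ∀ s < k + i, L (q * X ^ s) = 0)
    (r : ℂ[X]) (hr0 : r ≠ 0) (hr : r.natDegree ≤ k + i) (hL : ∀ t < k, L (r * X ^ t) = 0) :
    ∃ a : ℂ[X], a ≠ 0 ∧ r = q * a ∧ a.natDegree ≤ i := by
  have hd : (r /ₘ q).natDegree ≤ i := by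
    rw [natDegree_divByMonic _ hq, natDegree_eq_of_degree_eq_some hqd]; omega
  have hb : r %ₘ q = 0 := by
    apply aux_nonsing L m hm k hΔ
    · rw [← hqd]; exact degree_modByMonic_lt _ hq
    · intro t ht
      have e : (r %ₘ q) * X ^ t = r * X ^ t - q * ((r /ₘ q) * X ^ t) := by
        linear_combination X ^ t * modByMonic_add_div r q
      rw [e, map_sub, hL t ht, aux_ext L q (k + i) h, sub_zero]
      refine degree_le_natDegree.trans_lt ?_
      have : ((r /ₘ q) * X ^ t).natDegree ≤ (r /ₘ q).natDegree + t := by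
        simpa using natDegree_mul_le (p := r /ₘ q) (q := X ^ t)
      exact_mod_cast (by omega)
  have e : r = q * (r /ₘ q) := by
    conv_lhs => rw [← modByMonic_add_div r q, hb, zero_add]
  refine ⟨r /ₘ q, ?_, e, hd⟩
  intro h0
  rw [h0, mul_zero] at e
  exact hr0 e

lemma aux_zero (L : Polynomial ℂ →ₗ[ℂ] ℂ) (m : ℕ → ℂ) (hm : ∀ i, m i = L (X ^ i))
    (k : ℕ) (hΔ : hankelDet m k ≠ 0) (q : ℂ[X]) (hq : q.Monic) (hqd : q.degree = k)
    (hqL : ∀ t < k, L (q * X ^ t) = 0) (N : ℕ)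
    (hz : ∀ i < N, hankelDet m (k + 1 + i) = 0) :
    ∀ i ≤ N, ∀ s < k + i, L (q * X ^ s) = 0 := by
  intro i
  induction i with
  | zero => intro _; simpa using hqL
  | succ i ih =>
    intro hi s hs
    have ih := ih (by omega)
    rcases Nat.lt_or_ge s (k + i) with hlt | hge
    · exact ih s hlt
    obtain rfl : s = k + i := by omega
    obtain ⟨r, hr0, hrd, hrL⟩ := aux_sing L m hm _ (hz i (by omega))
    have hrn := (natDegree_lt_iff_degree_lt hr0).2 hrd
    obtain ⟨a, ha0, rfl, had⟩ := aux_div L m hm k hΔ q hq hqd i ih r hr0 (by omega)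
      (fun t ht => hrL t (by omega))
    have h1 := hrL (k + i - a.natDegree) (by omega)
    have e : q * a * X ^ (k + i - a.natDegree) = q * (a.eraseLead * X ^ (k + i - a.natDegree))
        + C a.leadingCoeff * (q * X ^ (k + i)) := by
      have : (X : ℂ[X]) ^ (k + i) = X ^ a.natDegree * X ^ (k + i - a.natDegree) := by
        rw [← pow_add]; congr 1; omega
      rw [this]
      linear_combination (-(q * X ^ (k + i - a.natDegree))) * eraseLead_add_C_mul_X_pow a
    rw [e, map_add, ← smul_eq_C_mul, map_smul, aux_ext L q (k + i) ih, zero_add, smul_eq_mul] at h1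
    · exact (mul_eq_zero.1 h1).resolve_left (leadingCoeff_ne_zero.2 ha0)
    · have hlt := degree_eraseLead_lt ha0
      rw [degree_eq_natDegree ha0] at hlt
      by_cases h0 : a.eraseLead = 0
      · rw [h0, zero_mul, degree_zero]; exact WithBot.bot_lt_coe _
      rw [degree_eq_natDegree h0] at hlt
      have hlt : a.eraseLead.natDegree < a.natDegree := by exact_mod_cast hlt
      rw [degree_mul, degree_X_pow, degree_eq_natDegree h0]
      exact_mod_cast (by omega)

/-- Assume `Δ_{k−1} ≠ 0` and `Δ_{k+i} = 0` for `i = 0, …, 2j−1`. Then for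
every `0 ≤ i ≤ j`, a polynomial of degree `k + i` is a FOP w.r.t. `L` (orthogonal to
`λ^t` for `t < k + i`) iff it is quasi-orthogonal of order `i` (orthogonal to `λ^t` for
`t < k`). -/
theorem stmt6 (L : Polynomial ℂ →ₗ[ℂ] ℂ) (m : ℕ → ℂ) (hm : ∀ i, m i = L (X ^ i))
    (k j : ℕ) (hk : 1 ≤ k)
    (hΔ : hankelDet m k ≠ 0)
    (hzeros : ∀ i < 2 * j, hankelDet m (k + 1 + i) = 0) :
    ∀ i ≤ j, ∀ p : Polynomial ℂ, p.degree = ((k + i : ℕ) : WithBot ℕ) →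
      ((∀ t < k + i, L (p * X ^ t) = 0) ↔ (∀ t < k, L (p * X ^ t) = 0)) := by
  intro i hi p hp
  have hp0 : p ≠ 0 := by rintro rfl; rw [degree_zero] at hp; exact WithBot.bot_ne_coe hp
  have hpn := natDegree_eq_of_degree_eq_some hp
  refine ⟨fun h t ht => h t (by omega), fun h => ?_⟩
  obtain ⟨q, hq, hqd, hqL⟩ := aux_fop L m hm k hΔ
  have hz := aux_zero L m hm k hΔ q hq hqd hqL (2 * j) hzeros
  obtain ⟨a, ha0, rfl, had⟩ := aux_div L m hm k hΔ q hq hqd i (hz i (by omega)) p hp0 (by omega) h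
  intro t ht
  rw [mul_assoc]
  refine aux_ext L q _ (hz (2 * j) le_rfl) _ ?_
  rw [degree_mul, degree_X_pow, degree_eq_natDegree ha0]
  exact_mod_cast (by omega)
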